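/- Let A be an infinite-dimensional simple unital C*-algebra, let G be a finite group with card(G) = n, let α : G → Aut(A) be an action of G on A, and let x ∈ A be a nonzero positive element. Then there exists a nonzero positive element y ∈ A such that the diagonal matrix diag(y, α_{g_1}(y), …, α_{g_n}(y)) ∈ M_{n+1}(A) (where g_1, …, g_n is an enumeration of G) is Cuntz subequivalent in M_{n+1}(A) to the matrix diag(x, 0, …, 0). -/

import Mathlib

open Filter Topology

/-- Cuntz subequivalence: `a ≾ b` iff there is a sequence `vₙ` with `‖a - vₙ b vₙ*‖ → 0`. -/
def CuntzSubeq {A : Type*} [NonUnitalRing A] [StarRing A] [Norm A] (a b : A) : Prop :=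
  ∃ v : ℕ → A, Filter.Tendsto (fun n => ‖a - v n * b * star (v n)‖) Filter.atTop (nhds (0 : ℝ))

-- Equip matrices over a C*-algebra with the (sup of sup) norm; any of the standard
-- choices of norm on a finite matrix algebra induces the same topology, so Cuntz
-- subequivalence in `M_{n+1}(A)` is unambiguous.
attribute [local instance] Matrix.normedAddCommGroup

section helpers

variable {A : Type*} [CStarAlgebra A] [PartialOrder A] [StarOrderedRing A]

/-- In a simple unital C*-algebra, every nonzero element is algebraically full. -/
lemma full_of_simple
    (hA : ∀ I : TwoSidedIdeal A, IsClosed (I : Set A) → I = ⊥ ∨ I = ⊤)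
    (b : A) (hb : b ≠ 0) :
    ∃ l : List (A × A), (1 : A) = (l.map fun q => q.1 * b * q.2).sum := by
  let S : AddSubgroup A :=
    { carrier := {s | ∃ l : List (A × A), s = (l.map fun q => q.1 * b * q.2).sum}
      zero_mem' := ⟨[], by simp⟩
      add_mem' := by
        rintro _ _ ⟨l, rfl⟩ ⟨m, rfl⟩
        exact ⟨l ++ m, by simp⟩
      neg_mem' := by
        rintro _ ⟨l, rfl⟩
        refine ⟨l.map fun q => (-q.1, q.2), ?_⟩
        induction l with
        | nil => simp
        | cons q l ih => simp at ih ⊢; rw [← ih]; abel }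
  have hl : ∀ c s, s ∈ S → c * s ∈ S := by
    rintro c _ ⟨l, rfl⟩
    refine ⟨l.map fun q => (c * q.1, q.2), ?_⟩
    simp [← List.sum_map_mul_left, Function.comp_def, mul_assoc]
  have hr : ∀ c s, s ∈ S → s * c ∈ S := by
    rintro c _ ⟨l, rfl⟩
    refine ⟨l.map fun q => (q.1, q.2 * c), ?_⟩
    simp [← List.sum_map_mul_right, Function.comp_def, mul_assoc]
  have hbS : b ∈ S := ⟨[(1, 1)], by simp⟩
  let T := S.topologicalClosure
  let I : TwoSidedIdeal A := TwoSidedIdeal.mk' (T : Set A) T.zero_mem T.add_mem T.neg_mem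
    (by
      intro c s hs
      exact map_mem_closure (f := fun s => c * s) (by fun_prop) hs (fun s hs => hl c s hs))
    (by
      intro s c hs
      exact map_mem_closure (f := fun s => s * c) (by fun_prop) hs (fun s hs => hr c s hs))
  have hI : (I : Set A) = T := TwoSidedIdeal.coe_mk' ..
  have hbI : b ∈ I := by
    rw [← SetLike.mem_coe, hI]; exact S.le_topologicalClosure hbS
  have h1 : (1 : A) ∈ closure (S : Set A) := by
    rcases hA I (by rw [hI]; exact S.isClosed_topologicalClosure) with h | h
    · rw [h] at hbI; exact absurd (by simpa using hbI) hb
    · have : (1 : A) ∈ (I : Set A) := by rw [h]; simp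
      rw [hI] at this; exact this
  obtain ⟨s, hs, hd⟩ := Metric.mem_closure_iff.1 h1 1 one_pos
  rw [dist_eq_norm] at hd
  have hu := isUnit_one_sub_of_norm_lt_one hd
  rw [sub_sub_cancel] at hu
  obtain ⟨t, ht⟩ := hu.exists_right_inv
  have := hr t s hs
  rw [ht] at this
  exact this

lemma prime_of_simple
    (hA : ∀ I : TwoSidedIdeal A, IsClosed (I : Set A) → I = ⊥ ∨ I = ⊤)
    (a b : A) (ha : a ≠ 0) (hb : b ≠ 0) : ∃ c, a * c * b ≠ 0 := by
  obtain ⟨l, hl⟩ := full_of_simple hA b hb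
  by_contra! h
  apply ha
  rw [← mul_one a, hl, ← List.sum_map_mul_left]
  simp [← mul_assoc, h]

/-- Two nonzero positive elements have a common nonzero positive lower bound. -/
lemma common_lower
    (hA : ∀ I : TwoSidedIdeal A, IsClosed (I : Set A) → I = ⊥ ∨ I = ⊤)
    (a b : A) (ha0 : 0 ≤ a) (hb0 : 0 ≤ b) (ha : a ≠ 0) (hb : b ≠ 0) :
    ∃ y, 0 ≤ y ∧ y ≠ 0 ∧ (∃ v, y = v * a * star v) ∧ ∃ v, y = v * b * star v := by
  obtain ⟨s, rfl⟩ := CStarAlgebra.nonneg_iff_eq_star_mul_self.1 ha0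
  obtain ⟨t, rfl⟩ := CStarAlgebra.nonneg_iff_eq_star_mul_self.1 hb0
  have hs : star s ≠ 0 := by rintro h; simp [h] at ha
  have ht : t ≠ 0 := by rintro rfl; simp at hb
  obtain ⟨c, hc⟩ := prime_of_simple hA t (star s) ht hs
  set z := t * c * star s with hz
  have hzz : z * star z ≠ 0 := by simpa using hc
  have hzn : 0 ≤ z * star z := mul_star_self_nonneg z
  set q := CFC.sqrt (z * star z) with hq
  have hqs : star q = q := (CFC.sqrt_nonneg _).isSelfAdjoint.star_eq
  have hqq : q * q = z * star z := CFC.sqrt_mul_sqrt_self _ hzn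
  have hne : (z * star z) * star (z * star z) ≠ 0 := by
    rwa [Ne, CStarRing.mul_star_self_eq_zero_iff]
  refine ⟨(z * star z) * star (z * star z), mul_star_self_nonneg _, hne,
    ⟨q * (t * c), ?_⟩, ⟨z * (s * star c), ?_⟩⟩
  · have h1 : q * (t * c) * (star s * s) * star (q * (t * c)) = q * (z * star z) * q := by
      simp [hz, hqs, mul_assoc]
    rw [h1, ← hqq, star_mul, hqs]
    simp only [mul_assoc]
  · simp [hz, mul_assoc]

lemma common_lower_finset
    (hA : ∀ I : TwoSidedIdeal A, IsClosed (I : Set A) → I = ⊥ ∨ I = ⊤) [Nontrivial A]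
    {ι : Type*} (a : ι → A) (h0 : ∀ i, 0 ≤ a i) (h : ∀ i, a i ≠ 0) (s : Finset ι) :
    ∃ y, 0 ≤ y ∧ y ≠ 0 ∧ ∀ i ∈ s, ∃ v, y = v * a i * star v := by
  classical
  induction s using Finset.induction_on with
  | empty => exact ⟨1, zero_le_one, one_ne_zero, by simp⟩
  | insert i s _ ih =>
    obtain ⟨y, hy0, hy, hv⟩ := ih
    obtain ⟨y', hy0', hy', ⟨v, h1⟩, w, h2⟩ := common_lower hA y (a i) hy0 (h0 i) hy (h i)
    refine ⟨y', hy0', hy', fun j hj => ?_⟩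
    rcases Finset.mem_insert.1 hj with rfl | hj
    · exact ⟨w, h2⟩
    · obtain ⟨u, hu⟩ := hv j hj
      exact ⟨v * u, by rw [h1, hu]; simp [mul_assoc]⟩

/-- An element comparable with all real multiples of `a` is a multiple of `a`. -/
lemma eq_smul_of_comparable (a b : A) (ha0 : 0 ≤ a) (ha : a ≠ 0)
    (h : ∀ t : ℝ, b ≤ t • a ∨ t • a ≤ b) : ∃ t : ℝ, b = t • a := by
  have key : ∀ c : A, (∀ n : ℕ, (n : ℝ) • a ≤ c) → False := by
    intro c hc
    apply ha
    refine le_antisymm ?_ ha0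
    have hlim : Tendsto (fun n : ℕ => ((n : ℝ) + 1)⁻¹ • c) atTop (𝓝 ((0 : ℝ) • c)) := by
      apply Tendsto.smul_const
      simpa using tendsto_one_div_add_atTop_nhds_zero_nat (𝕜 := ℝ)
    rw [zero_smul] at hlim
    refine ge_of_tendsto' hlim fun n => ?_
    have h1 := hc (n + 1)
    have hp : (0 : ℝ) < (n : ℝ) + 1 := by positivity
    have h2 := smul_le_smul_of_nonneg_left h1 (inv_nonneg.2 hp.le)
    rwa [smul_smul, Nat.cast_add, Nat.cast_one, inv_mul_cancel₀ hp.ne', one_smul] at h2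
  have hc1 : IsClosed {t : ℝ | b ≤ t • a} := isClosed_le (by fun_prop) (by fun_prop)
  have hc2 : IsClosed {t : ℝ | t • a ≤ b} := isClosed_le (by fun_prop) (by fun_prop)
  have hpre := isPreconnected_closed_iff.1 (PreconnectedSpace.isPreconnected_univ (α := ℝ))
    _ _ hc1 hc2 (fun t _ => h t)
  obtain ⟨t, -, h1, h2⟩ := hpre
    (by
      by_contra hne
      apply key b
      intro n
      rcases h n with h | h
      · exact absurd ⟨_, trivial, h⟩ hne
      · exact h)
    (by
      by_contra hne
      apply key (-b)
      intro n
      rcases h (-n) with h | h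
      · rw [neg_smul] at h; exact le_neg_of_le_neg h
      · exact absurd ⟨_, trivial, h⟩ hne)
  exact ⟨t, le_antisymm h1 h2⟩

lemma nonsplit_comm (x : A) (hx : 0 ≤ x)
    (hns : ∀ u v, u * x * star v = 0 → u * x * star u = 0 ∨ v * x * star v = 0)
    (k : A) (hk : IsSelfAdjoint k) (hkx : Commute k x) : k * x ≤ 0 ∨ 0 ≤ k * x := by
  have hp : Commute k⁺ x := hkx.cfcₙ_real _
  have hm : Commute k⁻ x := hkx.cfcₙ_real _
  have hp0 : 0 ≤ k⁺ := CFC.posPart_nonneg k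
  have hm0 : 0 ≤ k⁻ := CFC.negPart_nonneg k
  have hsplit := CFC.posPart_sub_negPart k hk
  have aux : ∀ w : A, 0 ≤ w → Commute w x → w * x * star w = 0 → w * x = 0 := by
    intro w hw hc h
    rw [← CStarRing.mul_star_self_eq_zero_iff, star_mul, hw.isSelfAdjoint.star_eq,
      hx.isSelfAdjoint.star_eq]
    rw [hw.isSelfAdjoint.star_eq] at h
    rw [← hc.eq, ← mul_assoc, h, zero_mul]
  have h0 : k⁺ * x * star k⁻ = 0 := by
    rw [hm0.isSelfAdjoint.star_eq, hp.eq, mul_assoc, CFC.posPart_mul_negPart, mul_zero]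
  rcases hns _ _ h0 with h | h
  · left
    have := aux _ hp0 hp h
    rw [← hsplit, sub_mul, this, zero_sub, neg_nonpos]
    exact hm.mul_nonneg hm0 hx
  · right
    have := aux _ hm0 hm h
    rw [← hsplit, sub_mul, this, sub_zero]
    exact hp.mul_nonneg hp0 hx

lemma nonsplit_corner (x : A) (hx : 0 ≤ x) (hx0 : x ≠ 0)
    (hns : ∀ u v, u * x * star v = 0 → u * x * star u = 0 ∨ v * x * star v = 0) :
    ∀ b : A, ∃ z : ℂ, x * b * x = z • x := by
  have hxs : star x = x := hx.isSelfAdjoint.star_eq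
  obtain ⟨r, hr⟩ : ∃ r : ℝ, x * x = r • x := by
    apply eq_smul_of_comparable x _ hx hx0
    intro t
    have hk : IsSelfAdjoint (x - t • (1 : A)) := by
      simp [IsSelfAdjoint, hxs]
    have := nonsplit_comm x hx hns (x - t • (1 : A)) hk
      (by simp [Commute, SemiconjBy, sub_mul, mul_sub])
    simpa [sub_mul] using this
  have hr0 : 0 < r := by
    by_contra! hle
    have h1 : x * x ≤ 0 := by rw [hr]; exact smul_nonpos_of_nonpos_of_nonneg hle hx
    have h2 : 0 ≤ x * x := by
      have := star_mul_self_nonneg x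
      rwa [hxs] at this
    have h3 : star x * x = 0 := by rw [hxs]; exact le_antisymm h1 h2
    exact hx0 (CStarRing.star_mul_self_eq_zero_iff x |>.1 h3)
  have hsa : ∀ b : A, IsSelfAdjoint b → ∃ t : ℝ, x * b * x = t • x := by
    intro b hb
    apply eq_smul_of_comparable x _ hx hx0
    intro t
    set k := x * b * x - t • x with hkdef
    have hkx : k * x = r • k := by
      simp only [hkdef, sub_mul, mul_assoc, hr, smul_mul_assoc, mul_smul_comm, smul_sub]
      rw [smul_comm]
    have hxk : x * k = r • k := by
      simp only [hkdef, mul_sub, ← mul_assoc, hr, smul_mul_assoc, mul_smul_comm, smul_sub]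
      rw [smul_comm]
    have hk : IsSelfAdjoint k := by
      simp [IsSelfAdjoint, hkdef, hxs, hb.star_eq, mul_assoc]
    have := nonsplit_comm x hx hns k hk (hkx.trans hxk.symm)
    rw [hkx] at this
    have hinv : r⁻¹ • r • k = k := by rw [smul_smul, inv_mul_cancel₀ hr0.ne', one_smul]
    rcases this with h | h
    · left
      have := smul_nonpos_of_nonneg_of_nonpos (inv_nonneg.2 hr0.le) h
      rw [hinv] at this
      exact sub_nonpos.1 this
    · right
      have := smul_nonneg (inv_nonneg.2 hr0.le) h
      rw [hinv] at this
      exact sub_nonneg.1 this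
  intro b
  obtain ⟨s, hs⟩ := hsa (realPart b) (realPart b).2
  obtain ⟨t, ht⟩ := hsa (imaginaryPart b) (imaginaryPart b).2
  refine ⟨s + Complex.I * t, ?_⟩
  conv_lhs => rw [← realPart_add_I_smul_imaginaryPart b]
  rw [mul_add, add_mul, hs, mul_smul_comm, smul_mul_assoc, ht, add_smul, mul_smul]
  simp

lemma exists_split
    (hA : ∀ I : TwoSidedIdeal A, IsClosed (I : Set A) → I = ⊥ ∨ I = ⊤)
    (hdim : ¬ FiniteDimensional ℂ A) (x : A) (hx : 0 ≤ x) (hx0 : x ≠ 0) :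
    ∃ u v, u * x * star v = 0 ∧ u * x * star u ≠ 0 ∧ v * x * star v ≠ 0 := by
  by_contra! hcon
  have hns : ∀ u v, u * x * star v = 0 → u * x * star u = 0 ∨ v * x * star v = 0 := by
    intro u v h
    by_cases h1 : u * x * star u = 0
    · exact Or.inl h1
    · exact Or.inr (hcon u v h h1)
  have hc := nonsplit_corner x hx hx0 hns
  obtain ⟨l, hl⟩ := full_of_simple hA x hx0
  apply hdim
  let T : Set A := (fun q : (A × A) × (A × A) => q.1.1 * x * q.2.2) ''
    ({q | q ∈ l} ×ˢ {q | q ∈ l})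
  have hT : T.Finite := ((List.finite_toSet l).prod (List.finite_toSet l)).image _
  have hspan : Submodule.span ℂ T = ⊤ := by
    rw [eq_top_iff]
    rintro a -
    have ha : a = (l.map fun q => q.1 * x * q.2).sum * a * (l.map fun q => q.1 * x * q.2).sum := by
      rw [← hl]; simp
    rw [ha, ← List.sum_map_mul_right, ← List.sum_map_mul_right]
    apply list_sum_mem
    intro y hy
    obtain ⟨q, hq, rfl⟩ := List.mem_map.1 hy
    rw [← List.sum_map_mul_left]
    apply list_sum_mem
    intro y hy
    obtain ⟨p, hp, rfl⟩ := List.mem_map.1 hy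
    obtain ⟨z, hz⟩ := hc (q.2 * a * p.1)
    have : q.1 * x * q.2 * a * (p.1 * x * p.2) = z • (q.1 * x * p.2) := by
      calc _ = q.1 * (x * (q.2 * a * p.1) * x) * p.2 := by simp only [mul_assoc]
        _ = _ := by rw [hz]; simp
    rw [this]
    exact Submodule.smul_mem _ _ (Submodule.subset_span ⟨(q, p), ⟨hq, hp⟩, rfl⟩)
  exact ⟨⟨hT.toFinset, by simpa using hspan⟩⟩

lemma exists_orthogonal
    (hA : ∀ I : TwoSidedIdeal A, IsClosed (I : Set A) → I = ⊥ ∨ I = ⊤)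
    (hdim : ¬ FiniteDimensional ℂ A) (m : ℕ) : ∀ (x : A), 0 ≤ x → x ≠ 0 →
    ∃ u : Fin (m + 1) → A, (∀ i, u i * x * star (u i) ≠ 0) ∧
      ∀ i j, i ≠ j → u i * x * star (u j) = 0 := by
  induction m with
  | zero =>
    intro x hx hx0
    exact ⟨fun _ => 1, by simpa using hx0, fun i j h => absurd (by omega) h⟩
  | succ m ih =>
    intro x hx hx0
    obtain ⟨u, v, huv, hu, hv⟩ := exists_split hA hdim x hx hx0
    have hvu : v * x * star u = 0 := by
      have := congrArg star huv
      simpa [hx.isSelfAdjoint.star_eq, mul_assoc] using this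
    obtain ⟨w, hw1, hw2⟩ := ih (v * x * star v) (star_right_conjugate_nonneg hx v) hv
    refine ⟨Fin.cons u fun i => w i * v, ?_, ?_⟩
    · intro i
      refine Fin.cases ?_ (fun i => ?_) i
      · simpa using hu
      · simpa [mul_assoc] using hw1 i
    · intro i j
      refine Fin.cases ?_ (fun i => ?_) i <;> refine Fin.cases ?_ (fun j => ?_) j
      · simp
      · intro _
        simp only [Fin.cons_zero, Fin.cons_succ, star_mul]
        rw [← mul_assoc, huv, zero_mul]
      · intro _
        simp only [Fin.cons_zero, Fin.cons_succ]
        rw [mul_assoc, mul_assoc, ← mul_assoc v, hvu, mul_zero]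
      · intro h
        have := hw2 i j (fun h' => h (by rw [h']))
        simpa [mul_assoc] using this

end helpers

theorem exists_diag_orbit_cuntzSubeq_diag_x
    {A G : Type*} [CStarAlgebra A] [PartialOrder A] [StarOrderedRing A]
    (hA : ∀ I : TwoSidedIdeal A, IsClosed (I : Set A) → I = ⊥ ∨ I = ⊤)
    (hdim : ¬ FiniteDimensional ℂ A)
    [Group G] [Fintype G] (α : G →* (A ≃ₐ[ℂ] A))
    (hα : ∀ (g : G) (a : A), α g (star a) = star (α g a))
    {n : ℕ} (hn : Fintype.card G = n) (e : Fin n ≃ G)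
    (x : A) (hx : 0 ≤ x) (hx0 : x ≠ 0) :
    ∃ y : A, 0 ≤ y ∧ y ≠ 0 ∧
      CuntzSubeq
        (Matrix.diagonal (Fin.cons y (fun i : Fin n => α (e i) y)) :
          Matrix (Fin (n + 1)) (Fin (n + 1)) A)
        (Matrix.diagonal (Fin.cons x (fun _ : Fin n => (0 : A))) :
          Matrix (Fin (n + 1)) (Fin (n + 1)) A) := by
  have : Nontrivial A := ⟨x, 0, hx0⟩
  obtain ⟨u, hu, hortho⟩ := exists_orthogonal hA hdim n x hx hx0
  let γ : Fin (n + 1) → G := Fin.cons 1 e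
  have hinv : ∀ g a, α g (α g⁻¹ a) = a := by
    intro g a
    rw [← AlgEquiv.mul_apply, ← map_mul]; simp
  obtain ⟨y, hy0, hy, hv⟩ := common_lower_finset hA
    (fun i => α (γ i)⁻¹ (u i * x * star (u i)))
    (by
      intro i
      obtain ⟨s, hs⟩ := CStarAlgebra.nonneg_iff_eq_star_mul_self.1
        (star_right_conjugate_nonneg hx (u i))
      simp only [hs, map_mul (α (γ i)⁻¹), hα]
      exact star_mul_self_nonneg _)
    (fun i => by
      intro h
      exact hu i ((EmbeddingLike.map_eq_zero_iff (f := α (γ i)⁻¹)).1 h)) Finset.univ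
  choose v hv using fun i => hv i (Finset.mem_univ i)
  let w : Fin (n + 1) → A := fun i => α (γ i) (v i) * u i
  have hw : ∀ i, α (γ i) y = w i * x * star (w i) := by
    intro i
    conv_lhs => rw [hv i]
    rw [map_mul, map_mul, hinv, hα]
    simp [w, mul_assoc]
  have hw' : ∀ i j, i ≠ j → w i * x * star (w j) = 0 := by
    intro i j h
    have := hortho i j h
    calc w i * x * star (w j)
        = α (γ i) (v i) * (u i * x * star (u j)) * star (α (γ j) (v j)) := by
          simp [w, mul_assoc]
      _ = 0 := by rw [this]; simp
  have hd : (Fin.cons y (fun i : Fin n => α (e i) y) : Fin (n + 1) → A) =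
      fun i => α (γ i) y := by
    funext i
    refine Fin.cases ?_ (fun i => ?_) i <;> simp [γ]
  refine ⟨y, hy0, hy, fun _ => Matrix.of fun i j => if j = 0 then w i else 0, ?_⟩
  have heq : (Matrix.diagonal (Fin.cons y (fun i : Fin n => α (e i) y)) :
          Matrix (Fin (n + 1)) (Fin (n + 1)) A) =
      (Matrix.of fun i j => if j = 0 then w i else 0) *
        (Matrix.diagonal (Fin.cons x (fun _ : Fin n => (0 : A))) :
          Matrix (Fin (n + 1)) (Fin (n + 1)) A) *
        star (Matrix.of fun i j => if j = 0 then w i else 0) := by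
    rw [hd]
    ext i j
    rw [Matrix.mul_apply, Fin.sum_univ_succ]
    simp only [Matrix.mul_diagonal, Matrix.star_apply, Matrix.of_apply]
    by_cases h : i = j
    · subst h
      simp [hw i]
    · simp [Matrix.diagonal_apply_ne _ h, hw' i j h]
  beta_reduce
  rw [← heq]
  simp
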